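/- Perturbation of the symplectic spectrum to first order, infinite-time form (Lemma 3.2(i)): Let m, n ≥ 1 and let M_AB be a real symmetric positive-definite matrix of size 2(m+n) with diagonal blocks M_A (size 2m) and M_B (size 2n). Let ν₁,…,ν_n be the symplectic eigenvalues of M_B (in some fixed order). Then there exist constants C > 0 and ε₀ > 0 such that for every ε ∈ (0, ε₀) there are orderings λ₁(ε),…,λ_{m+n}(ε) of the symplectic eigenvalues (with multiplicity) of the positive-definite matrix (I_A⊕0_B) + ε·M_AB and η₁(ε),…,η_m(ε) of the symplectic eigenvalues of I_{2m} + ε·M_A such that |λ_j(ε) − η_j(ε)| ≤ C·ε² for j = 1,…,m and |λ_{m+j}(ε) − ε·ν_j| ≤ C·ε² for j = 1,…,n. -/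

import Mathlib

open scoped Classical ComplexOrder

noncomputable section

/-- The function `g(x) = (x+1)·log(x+1) − x·log x` (with `g 0 = 0` since `log 0 = 0`). -/
def gFn (x : ℝ) : ℝ := (x + 1) * Real.log (x + 1) - x * Real.log x

/-- Single-mode entropy as a function of the symplectic eigenvalue: `G(λ) = g((λ−1)/2)`. -/
def GFn (lam : ℝ) : ℝ := gFn ((lam - 1) / 2)

/-- Inverse temperature `β(λ) = log((λ+1)/(λ−1))`. -/
def betaFn (lam : ℝ) : ℝ := Real.log ((lam + 1) / (lam - 1))

/-- The standard symplectic form matrix on `ℝ^d` (for even `d = 2N` this is the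
block-diagonal matrix with `N` diagonal blocks `[[0,1],[-1,0]]`). -/
def Jmat (d : ℕ) : Matrix (Fin d) (Fin d) ℝ := fun i j =>
  if (i : ℕ) % 2 = 0 ∧ (j : ℕ) = (i : ℕ) + 1 then 1
  else if (j : ℕ) % 2 = 0 ∧ (i : ℕ) = (j : ℕ) + 1 then -1 else 0

/-- A real `d×d` matrix is symplectic if `S·J·Sᵀ = J`. -/
def IsSymplectic {d : ℕ} (S : Matrix (Fin d) (Fin d) ℝ) : Prop :=
  S * Jmat d * S.transpose = Jmat d

/-- The doubled diagonal matrix `D(λ) = diag(λ₀,λ₀,λ₁,λ₁,…)`. -/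
def Dmat (d : ℕ) (lam : ℕ → ℝ) : Matrix (Fin d) (Fin d) ℝ :=
  Matrix.diagonal fun i => lam ((i : ℕ) / 2)

/-- A valid quantum covariance matrix: `M` symmetric with `M + i·J ⪰ 0`. -/
def IsQCov {d : ℕ} (M : Matrix (Fin d) (Fin d) ℝ) : Prop :=
  M.IsSymm ∧
    (M.map (Complex.ofReal) + Complex.I • (Jmat d).map Complex.ofReal).PosSemidef

/-- Entropy functional `E(M) = Σⱼ G(λⱼ)` where `λⱼ` are the symplectic eigenvalues of `M`:
the eigenvalues of `i·J·M` are `±λⱼ`, so `E(M) = (1/2)·Σ_{μ root of charpoly} G(|Re μ|)`. -/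
def Ent {d : ℕ} (M : Matrix (Fin d) (Fin d) ℝ) : ℝ :=
  ((Matrix.charpoly (Complex.I • ((Jmat d * M).map Complex.ofReal))).roots.map
    fun μ => GFn |μ.re|).sum / 2

/-- The matrix `I_A ⊕ 0_B`: identity on the first `a` coordinates, zero on the rest. -/
def IA0B (d a : ℕ) : Matrix (Fin d) (Fin d) ℝ :=
  Matrix.diagonal fun i => if (i : ℕ) < a then 1 else 0

/-- Assemble a symmetric 2×2 block matrix `[[A, K], [Kᵀ, B]]`. -/
def assemble2 {a b : ℕ} (A : Matrix (Fin a) (Fin a) ℝ) (K : Matrix (Fin a) (Fin b) ℝ)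
    (B : Matrix (Fin b) (Fin b) ℝ) : Matrix (Fin (a + b)) (Fin (a + b)) ℝ := fun i j =>
  if hi : (i : ℕ) < a then
    if hj : (j : ℕ) < a then A ⟨i, hi⟩ ⟨j, hj⟩
    else K ⟨i, hi⟩ ⟨(j : ℕ) - a, by have := j.isLt; omega⟩
  else
    if hj : (j : ℕ) < a then K ⟨j, hj⟩ ⟨(i : ℕ) - a, by have := i.isLt; omega⟩
    else B ⟨(i : ℕ) - a, by have := i.isLt; omega⟩ ⟨(j : ℕ) - a, by have := j.isLt; omega⟩

/-- Assemble the symmetric 3×3 block matrix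
`[[Y, K₁, K₂], [K₁ᵀ, B₁, 0], [K₂ᵀ, 0, B₂]]`. -/
def assemble3 {a b c : ℕ} (Y : Matrix (Fin a) (Fin a) ℝ)
    (K₁ : Matrix (Fin a) (Fin b) ℝ) (K₂ : Matrix (Fin a) (Fin c) ℝ)
    (B₁ : Matrix (Fin b) (Fin b) ℝ) (B₂ : Matrix (Fin c) (Fin c) ℝ) :
    Matrix (Fin (a + b + c)) (Fin (a + b + c)) ℝ := fun i j =>
  if hi : (i : ℕ) < a then
    if hj : (j : ℕ) < a then Y ⟨i, hi⟩ ⟨j, hj⟩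
    else if hj' : (j : ℕ) < a + b then K₁ ⟨i, hi⟩ ⟨(j : ℕ) - a, by omega⟩
    else K₂ ⟨i, hi⟩ ⟨(j : ℕ) - a - b, by have := j.isLt; omega⟩
  else if hi' : (i : ℕ) < a + b then
    if hj : (j : ℕ) < a then K₁ ⟨j, hj⟩ ⟨(i : ℕ) - a, by omega⟩
    else if hj' : (j : ℕ) < a + b then
      B₁ ⟨(i : ℕ) - a, by omega⟩ ⟨(j : ℕ) - a, by omega⟩
    else 0
  else
    if hj : (j : ℕ) < a then K₂ ⟨j, hj⟩ ⟨(i : ℕ) - a - b, by have := i.isLt; omega⟩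
    else if hj' : (j : ℕ) < a + b then 0
    else B₂ ⟨(i : ℕ) - a - b, by have := i.isLt; omega⟩
      ⟨(j : ℕ) - a - b, by have := j.isLt; omega⟩

open Matrix

/-- The symplectic form on `ι ⊕ ι`. -/
def stdJ (ι : Type*) [DecidableEq ι] : Matrix (ι ⊕ ι) (ι ⊕ ι) ℝ := fromBlocks 0 1 (-1) 0

/-- The diagonal matrix with each `lam j` repeated twice. -/
def doubleDiag {ι : Type*} [DecidableEq ι] (lam : ι → ℝ) : Matrix (ι ⊕ ι) (ι ⊕ ι) ℝ :=
  fromBlocks (diagonal lam) 0 0 (diagonal lam)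

/-- `lam` lists the symplectic eigenvalues of `M` with respect to the skew form `ω`. -/
def HasSymplecticSpectrum {ι X : Type*} [DecidableEq ι] [Fintype X] (ω M : Matrix X X ℝ)
    (lam : ι → ℝ) : Prop :=
  ∃ S : Matrix (ι ⊕ ι) X ℝ, S * ω * Sᵀ = stdJ ι ∧ S * M * Sᵀ = doubleDiag lam

open scoped RealInnerProductSpace in
/-- A skew-adjoint injective operator has orthonormal families of invariant planes, up to
exhausting the space. -/
theorem exists_skew_normal_pairs {V : Type*} [NormedAddCommGroup V] [InnerProductSpace ℝ V]
    [FiniteDimensional ℝ V] (T : V →ₗ[ℝ] V) (hT : ∀ x y, ⟪T x, y⟫ = -⟪x, T y⟫)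
    (hinj : Function.Injective T) (k : ℕ) (hk : 2 * k ≤ Module.finrank ℝ V) :
    ∃ (e f : Fin k → V) (κ : Fin k → ℝ), (∀ i, 0 < κ i) ∧
      (∀ i, T (f i) = κ i • e i) ∧ (∀ i, T (e i) = -(κ i • f i)) ∧
      (∀ i j, ⟪e i, e j⟫ = if i = j then 1 else 0) ∧
      (∀ i j, ⟪f i, f j⟫ = if i = j then 1 else 0) ∧ (∀ i j, ⟪e i, f j⟫ = 0) := by
  induction k with
  | zero => exact ⟨Fin.elim0, Fin.elim0, Fin.elim0, by simp⟩
  | succ k ih =>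
    obtain ⟨e, f, κ, hκ, hTf, hTe, hee, hff, hef⟩ := ih (by omega)
    set U : Submodule ℝ V := Submodule.span ℝ (Set.range (Sum.elim e f)) with hU
    have hmem : ∀ x, x ∈ Uᗮ ↔ (∀ i, ⟪e i, x⟫ = 0) ∧ ∀ i, ⟪f i, x⟫ = 0 := by
      intro x
      constructor
      · intro hx
        exact ⟨fun i => hx _ (Submodule.subset_span ⟨Sum.inl i, rfl⟩),
          fun i => hx _ (Submodule.subset_span ⟨Sum.inr i, rfl⟩)⟩
      · rintro ⟨h1, h2⟩
        rw [Submodule.mem_orthogonal]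
        intro u hu
        induction hu using Submodule.span_induction with
        | mem u hu => obtain ⟨i | i, rfl⟩ := hu; exacts [h1 i, h2 i]
        | zero => simp
        | add u v _ _ hu hv => rw [inner_add_left, hu, hv, add_zero]
        | smul c u _ hu => rw [real_inner_smul_left, hu, mul_zero]
    have hTU : ∀ x ∈ Uᗮ, T x ∈ Uᗮ := by
      intro x hx
      rw [hmem] at hx ⊢
      constructor
      · intro i
        have := hT (e i) x
        rw [hTe, inner_neg_left, real_inner_smul_left, hx.2] at this
        linarith
      · intro i
        have := hT (f i) x
        rw [hTf, real_inner_smul_left, hx.1] at this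
        linarith
    have hTTU : ∀ x ∈ Uᗮ, (T ∘ₗ T) x ∈ Uᗮ := fun x hx => hTU _ (hTU _ hx)
    have hsymm : (T ∘ₗ T).IsSymmetric := by
      intro x y
      rw [LinearMap.comp_apply, LinearMap.comp_apply, hT, hT, neg_neg]
    have hUdim : Module.finrank ℝ U ≤ k + k := by
      exact (finrank_range_le_card (R := ℝ) (Sum.elim e f)).trans (by simp)
    have hnt : Nontrivial Uᗮ := by
      have := U.finrank_add_finrank_orthogonal
      exact Module.nontrivial_of_finrank_pos (R := ℝ) (by omega)
    have hev := (hsymm.restrict_invariant hTTU).hasEigenvalue_iSup_of_finiteDimensional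
    obtain ⟨v, hv⟩ := hev.exists_hasEigenvector
    obtain ⟨μ, hμ⟩ : ∃ μ : ℝ, T (T v) = μ • (v : V) :=
      ⟨_, congrArg Subtype.val hv.apply_eq_smul⟩
    have hv0 : (v : V) ≠ 0 := fun h => hv.2 (Subtype.ext h)
    have hnorm : ‖(v : V)‖ ≠ 0 := norm_ne_zero_iff.2 hv0
    set w : V := ‖(v : V)‖⁻¹ • (v : V) with hw
    have hwU : w ∈ Uᗮ := Submodule.smul_mem _ _ v.2
    have hww : ⟪w, w⟫ = 1 := by
      rw [hw, real_inner_smul_left, real_inner_smul_right, real_inner_self_eq_norm_sq]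
      field_simp
    have hTTw : T (T w) = μ • w := by rw [hw, map_smul, map_smul, hμ, smul_comm]
    have hw0 : w ≠ 0 := by rintro h; simp [h] at hww
    have hTw0 : T w ≠ 0 := fun h => hw0 (hinj (by rw [h, map_zero]))
    set c := ‖T w‖ with hc
    have hc0 : 0 < c := norm_pos_iff.2 hTw0
    have hcc : ⟪T w, T w⟫ = c ^ 2 := real_inner_self_eq_norm_sq _
    have hμc : μ = -c ^ 2 := by
      have := hT w (T w)
      rw [hTTw, real_inner_smul_right, hww, hcc] at this
      linarith
    have hskew : ⟪T w, w⟫ = 0 := by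
      have := hT w w
      rw [real_inner_comm] at this
      rw [real_inner_comm]
      linarith
    have hTwU := hTU w hwU
    rw [hmem] at hwU hTwU
    refine ⟨Fin.cons (c⁻¹ • T w) e, Fin.cons w f, Fin.cons c κ, ?_, ?_, ?_, ?_, ?_, ?_⟩
    · intro i; cases i using Fin.cases <;> simp [hc0, hκ]
    · intro i; cases i using Fin.cases <;> simp [hc0.ne', hTf]
    · intro i
      cases i using Fin.cases
      · simp only [Fin.cons_zero, map_smul, hTTw, hμc, smul_smul, ← neg_smul]
        congr 1; field_simp
      · simp [hTe]
    · intro i j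
      cases i using Fin.cases <;> cases j using Fin.cases <;>
        simp only [Fin.cons_zero, Fin.cons_succ, real_inner_smul_left, real_inner_smul_right, hcc,
          hTwU.1, hee, real_inner_comm (e _) (T w), Fin.succ_ne_zero, (Fin.succ_ne_zero _).symm,
          Fin.succ_inj, if_true, if_false, mul_zero]
      field_simp
    · intro i j
      cases i using Fin.cases <;> cases j using Fin.cases <;>
        simp only [Fin.cons_zero, Fin.cons_succ, hwU.2, hff, hww, real_inner_comm (f _) w,
          Fin.succ_ne_zero, (Fin.succ_ne_zero _).symm, Fin.succ_inj, if_true, if_false]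
    · intro i j
      cases i using Fin.cases <;> cases j using Fin.cases <;>
        simp [real_inner_smul_left, hskew, hwU.1, hef, hTwU.2, real_inner_comm (f _) (T w)]

theorem exists_isUnit_congruence_one {X : Type*} [Fintype X] [DecidableEq X] {M : Matrix X X ℝ}
    (hM : M.PosDef) : ∃ G : Matrix X X ℝ, IsUnit G ∧ G * M * Gᵀ = 1 := by
  open scoped MatrixOrder in
  obtain ⟨y, hy⟩ := CStarAlgebra.nonneg_iff_eq_star_mul_self.mp hM.posSemidef.nonneg
  rw [star_eq_conjTranspose, conjTranspose_eq_transpose_of_trivial] at hy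
  have hyu : IsUnit y := by
    have := hM.isUnit
    rw [hy, isUnit_iff_isUnit_det, det_mul, IsUnit.mul_iff] at this
    exact (isUnit_iff_isUnit_det _).2 this.2
  have hyd := (isUnit_iff_isUnit_det _).1 hyu
  refine ⟨(y⁻¹)ᵀ, ?_, ?_⟩
  · rw [isUnit_iff_isUnit_det, det_transpose, ← isUnit_iff_isUnit_det]
    exact isUnit_nonsing_inv_iff.2 hyu
  · rw [hy, transpose_transpose]
    calc _ = (y * y⁻¹)ᵀ * (y * y⁻¹) := by rw [transpose_mul]; simp only [Matrix.mul_assoc]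
      _ = 1 := by rw [mul_nonsing_inv _ hyd]; simp

/-- Williamson's theorem with respect to an arbitrary nondegenerate skew form. -/
theorem exists_hasSymplecticSpectrum {X : Type*} [Fintype X] [DecidableEq X] {N : ℕ}
    (hX : Fintype.card X = 2 * N) {ω M : Matrix X X ℝ} (hω : ωᵀ = -ω) (hωu : IsUnit ω)
    (hM : M.PosDef) : ∃ lam : Fin N → ℝ, HasSymplecticSpectrum ω M lam := by
  obtain ⟨G, hGu, hGM⟩ := exists_isUnit_congruence_one hM
  set K := G * ω * Gᵀ with hK
  have hKskew : Kᵀ = -K := by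
    rw [hK]; simp [transpose_mul, hω, Matrix.mul_assoc]
  have hKu : IsUnit K := (hGu.mul hωu).mul (by
    rwa [isUnit_iff_isUnit_det, det_transpose, ← isUnit_iff_isUnit_det])
  have hinner : ∀ x y : EuclideanSpace ℝ X, inner ℝ x y = x.ofLp ⬝ᵥ y.ofLp := by
    intro x y
    rw [EuclideanSpace.inner_eq_star_dotProduct, dotProduct_comm]; simp
  obtain ⟨e, f, κ, hκ, hKf, hKe, hee, hff, hef⟩ := exists_skew_normal_pairs
    (V := EuclideanSpace ℝ X) (toEuclideanLin K) (by
      intro x y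
      simp only [hinner, toLpLin_apply]
      rw [dotProduct_mulVec, ← mulVec_transpose, hKskew, neg_mulVec, neg_dotProduct, neg_neg])
    (by
      intro x y hxy
      have := congrArg WithLp.ofLp hxy
      simp only [toLpLin_apply] at this
      exact WithLp.ofLp_injective _ ((mulVec_injective_iff_isUnit).2 hKu this))
    N (by simp [hX])
  simp only [hinner] at hee hff hef
  replace hKf : ∀ i, K *ᵥ (f i).ofLp = κ i • (e i).ofLp := fun i => by
    simpa using congrArg WithLp.ofLp (hKf i)
  replace hKe : ∀ i, K *ᵥ (e i).ofLp = -(κ i • (f i).ofLp) := fun i => by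
    simpa using congrArg WithLp.ofLp (hKe i)
  have hfe : ∀ i j, (f i).ofLp ⬝ᵥ (e j).ofLp = 0 := fun i j => by rw [dotProduct_comm, hef]
  set s : Fin N ⊕ Fin N → ℝ := Sum.elim (fun i => (√(κ i))⁻¹) (fun i => (√(κ i))⁻¹)
  set O : Matrix (Fin N ⊕ Fin N) X ℝ := of (Sum.elim (fun i => (e i).ofLp) fun i => (f i).ofLp)
  have hs : ∀ i, √(κ i) * √(κ i) = κ i := fun i => Real.mul_self_sqrt (hκ i).le
  have hs0 : ∀ i, √(κ i) ≠ 0 := fun i => (Real.sqrt_pos.2 (hκ i)).ne'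
  have hOl : ∀ i, O (Sum.inl i) = (e i).ofLp := fun i => rfl
  have hOr : ∀ i, O (Sum.inr i) = (f i).ofLp := fun i => rfl
  have hOO : O * Oᵀ = 1 := by
    ext i j
    have : (O * Oᵀ) i j = O i ⬝ᵥ O j := rfl
    rw [this]
    rcases i with i | i <;> rcases j with j | j <;>
      simp [hOl, hOr, hee, hff, hef, hfe, one_apply]
  have hOK : O * K * Oᵀ = fromBlocks 0 (diagonal κ) (-diagonal κ) 0 := by
    ext i j
    have : (O * K * Oᵀ) i j = O i ⬝ᵥ K *ᵥ (O j) := by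
      rw [Matrix.mul_assoc]; rfl
    rw [this]
    rcases i with i | i <;> rcases j with j | j <;>
      simp only [hOl, hOr, hKf, hKe, hee, hff, hef, hfe, diagonal_apply, dotProduct_neg,
        dotProduct_smul, fromBlocks_apply₁₁, fromBlocks_apply₁₂, fromBlocks_apply₂₁,
        fromBlocks_apply₂₂, Matrix.zero_apply, Matrix.neg_apply, smul_eq_mul, mul_zero, neg_zero,
        mul_ite, mul_one]
    all_goals by_cases h : i = j <;> simp [h]
  refine ⟨fun i => (κ i)⁻¹, diagonal s * O * G, ?_, ?_⟩
  · calc _ = diagonal s * (O * K * Oᵀ) * diagonal s := by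
          simp only [hK, transpose_mul, diagonal_transpose, Matrix.mul_assoc]
      _ = _ := by
          rw [hOK]
          ext (i | i) (j | j) <;> simp [s, stdJ, diagonal_apply, one_apply]
          all_goals
            by_cases h : i = j
            · subst h
              have := hs i
              have := hs0 i
              simp only [if_true]
              field_simp
              nlinarith
            · simp [h]
  · calc _ = diagonal s * (O * (G * M * Gᵀ) * Oᵀ) * diagonal s := by
          simp only [transpose_mul, diagonal_transpose, Matrix.mul_assoc]
      _ = _ := by
          rw [hGM, Matrix.mul_one, hOO, Matrix.mul_one, diagonal_mul_diagonal]
          ext (i | i) (j | j) <;> simp [s, doubleDiag, diagonal_apply]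
          all_goals
            by_cases h : i = j
            · simp [h, ← mul_inv, hs]
            · simp [h]

theorem dotProduct_mulVec_mulVec {Y Y' : Type*} [Fintype Y] [Fintype Y'] (Q : Matrix Y Y' ℝ)
    (W : Matrix Y Y ℝ) (a b : Y' → ℝ) : (Q *ᵥ a) ⬝ᵥ W *ᵥ (Q *ᵥ b) = a ⬝ᵥ (Qᵀ * W * Q) *ᵥ b := by
  rw [← mulVec_mulVec, ← mulVec_mulVec, dotProduct_mulVec a Qᵀ, vecMul_transpose]

section Monotonicity

variable {ι : Type*} [DecidableEq ι] [Fintype ι]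

theorem stdJ_mulVec_inl (a : ι ⊕ ι → ℝ) (j : ι) : (stdJ ι *ᵥ a) (Sum.inl j) = a (Sum.inr j) := by
  simp [stdJ, fromBlocks_mulVec]

theorem stdJ_mulVec_inr (a : ι ⊕ ι → ℝ) (j : ι) : (stdJ ι *ᵥ a) (Sum.inr j) = -a (Sum.inl j) := by
  simp [stdJ, fromBlocks_mulVec, neg_mulVec]

theorem dotProduct_stdJ_mulVec (a b : ι ⊕ ι → ℝ) : a ⬝ᵥ stdJ ι *ᵥ b =
    ∑ j, (a (Sum.inl j) * b (Sum.inr j) - a (Sum.inr j) * b (Sum.inl j)) := by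
  rw [dotProduct, Fintype.sum_sum_type, ← Finset.sum_add_distrib]
  refine Finset.sum_congr rfl fun j _ => ?_
  rw [stdJ_mulVec_inl, stdJ_mulVec_inr]; ring

theorem dotProduct_doubleDiag_mulVec (lam : ι → ℝ) (a : ι ⊕ ι → ℝ) :
    a ⬝ᵥ doubleDiag lam *ᵥ a = ∑ j, lam j * (a (Sum.inl j) ^ 2 + a (Sum.inr j) ^ 2) := by
  rw [dotProduct, Fintype.sum_sum_type, ← Finset.sum_add_distrib]
  refine Finset.sum_congr rfl fun j _ => ?_
  simp [doubleDiag, mulVec_diagonal]; ring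

theorem stdJ_mul_self : stdJ ι * stdJ ι = -1 := by
  simp [stdJ, fromBlocks_multiply, ← fromBlocks_one, fromBlocks_neg]

theorem le_of_symplectic_congruence {N : ℕ} {P : Matrix (Fin N ⊕ Fin N) (Fin N ⊕ Fin N) ℝ}
    (hP : Pᵀ * stdJ (Fin N) * P = stdJ (Fin N)) {lam mu : Fin N → ℝ} (hlam : Antitone lam)
    (hmu : Antitone mu) (hpos : ∀ j, 0 < lam j)
    (hle : ∀ a, (P *ᵥ a) ⬝ᵥ doubleDiag lam *ᵥ (P *ᵥ a) ≤ a ⬝ᵥ doubleDiag mu *ᵥ a) (k : Fin N) :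
    lam k ≤ mu k := by
  by_contra! hk
  set J := stdJ (Fin N)
  let R : (Fin N ⊕ Fin N → ℝ) →ₗ[ℝ] (Fin N ⊕ Fin N → ℝ) := (P - J * P * J).mulVecLin
  let g : (Fin N ⊕ Fin N → ℝ) →ₗ[ℝ] ({j // j ≠ k} ⊕ {j // j ≠ k} → ℝ) :=
    LinearMap.pi (Sum.elim
      (fun j => if j.1 < k then LinearMap.proj (Sum.inl j.1)
        else LinearMap.proj (Sum.inl j.1) ∘ₗ R)
      (fun j => if j.1 < k then LinearMap.proj (Sum.inr j.1)
        else LinearMap.proj (Sum.inr j.1) ∘ₗ R))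
  have hker : LinearMap.ker g ≠ ⊥ := by
    apply LinearMap.ker_ne_bot_of_finrank_lt
    have : 0 < N := k.pos
    simp only [Module.finrank_fintype_fun_eq_card, Fintype.card_sum, Fintype.card_subtype_compl,
      Fintype.card_subtype_eq, Fintype.card_fin, ne_eq]
    omega
  obtain ⟨a, hag, ha0⟩ := (Submodule.ne_bot_iff _).1 hker
  rw [LinearMap.mem_ker] at hag
  have hlt : ∀ j < k, a (Sum.inl j) = 0 ∧ a (Sum.inr j) = 0 := by
    intro j hj
    have h1 := congrFun hag (Sum.inl ⟨j, hj.ne⟩)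
    have h2 := congrFun hag (Sum.inr ⟨j, hj.ne⟩)
    simp [g, hj] at h1 h2
    exact ⟨h1, h2⟩
  set p := P *ᵥ a with hp
  set q := P *ᵥ (J *ᵥ a) with hq
  have hgt : ∀ j, k < j → p (Sum.inl j) = q (Sum.inr j) ∧ p (Sum.inr j) = -q (Sum.inl j) := by
    intro j hj
    have hR : R a = p - J *ᵥ q := by
      simp [R, hp, hq, mulVec_mulVec, Matrix.mul_assoc]
    have h1 := congrFun hag (Sum.inl ⟨j, hj.ne'⟩)
    have h2 := congrFun hag (Sum.inr ⟨j, hj.ne'⟩)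
    simp only [g, LinearMap.pi_apply, Sum.elim_inl, Sum.elim_inr, hj.not_gt, if_false,
      LinearMap.comp_apply, LinearMap.proj_apply, hR, Pi.sub_apply, Pi.zero_apply, J,
      stdJ_mulVec_inl, stdJ_mulVec_inr] at h1 h2
    constructor <;> linarith
  have hpq : p ⬝ᵥ J *ᵥ q = -∑ j, (a (Sum.inl j) ^ 2 + a (Sum.inr j) ^ 2) := by
    have : p ⬝ᵥ J *ᵥ q = a ⬝ᵥ J *ᵥ (J *ᵥ a) := by
      rw [hp, hq, dotProduct_mulVec_mulVec, hP]
    rw [this, dotProduct_stdJ_mulVec, ← Finset.sum_neg_distrib]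
    refine Finset.sum_congr rfl fun j _ => ?_
    rw [stdJ_mulVec_inl, stdJ_mulVec_inr]; ring
  have h1 := hle a
  have h2 := hle (J *ᵥ a)
  rw [← hp] at h1
  rw [← hq] at h2
  rw [dotProduct_stdJ_mulVec] at hpq
  simp only [dotProduct_doubleDiag_mulVec, J, stdJ_mulVec_inl, stdJ_mulVec_inr] at h1 h2
  have hneg : ∑ j, (mu j - lam k) * (a (Sum.inl j) ^ 2 + a (Sum.inr j) ^ 2) < 0 := by
    obtain ⟨j, hj⟩ : ∃ j, 0 < a (Sum.inl j) ^ 2 + a (Sum.inr j) ^ 2 := by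
      by_contra! h
      refine ha0 (funext fun j => ?_)
      rcases j with j | j <;> simp only [Pi.zero_apply] <;>
        nlinarith [h j, sq_nonneg (a (Sum.inl j)), sq_nonneg (a (Sum.inr j))]
    have hmk : ∀ j, ¬ j < k → mu j - lam k < 0 := fun j hj => by
      linarith [hmu (not_lt.1 hj)]
    rw [← Finset.sum_const_zero (s := Finset.univ (α := Fin N))]
    refine Finset.sum_lt_sum (fun i _ => ?_) ⟨j, Finset.mem_univ _, ?_⟩
    · by_cases hi : i < k
      · simp [hlt i hi]
      · exact mul_nonpos_of_nonpos_of_nonneg (hmk i hi).le (by positivity)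
    · refine mul_neg_of_neg_of_pos (hmk j fun h => ?_) hj
      simp [hlt j h] at hj
  have hnonneg : 0 ≤ ∑ j, (lam j * (p (Sum.inl j) ^ 2 + p (Sum.inr j) ^ 2) +
      lam j * (q (Sum.inl j) ^ 2 + q (Sum.inr j) ^ 2) +
      2 * lam k * (p (Sum.inl j) * q (Sum.inr j) - p (Sum.inr j) * q (Sum.inl j))) := by
    refine Finset.sum_nonneg fun j _ => ?_
    have hj := hpos j
    have hk := hpos k
    rcases le_or_gt j k with h | h
    · have hjk := hlam h
      have : 0 ≤ (lam j - lam k) * (p (Sum.inl j) ^ 2 + p (Sum.inr j) ^ 2 +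
          q (Sum.inl j) ^ 2 + q (Sum.inr j) ^ 2) :=
        mul_nonneg (by linarith) (by positivity)
      have : 0 ≤ lam k * ((p (Sum.inl j) + q (Sum.inr j)) ^ 2 +
        (p (Sum.inr j) - q (Sum.inl j)) ^ 2) := by positivity
      nlinarith
    · obtain ⟨e1, e2⟩ := hgt j h
      rw [e1, e2]
      have : 0 ≤ lam j * (q (Sum.inl j) ^ 2 + q (Sum.inr j) ^ 2) := by positivity
      have : 0 ≤ lam k * (q (Sum.inl j) ^ 2 + q (Sum.inr j) ^ 2) := by positivity
      nlinarith
  rw [Finset.sum_add_distrib, Finset.sum_add_distrib, ← Finset.mul_sum, hpq] at hnonneg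
  simp only [sub_mul, Finset.sum_sub_distrib, ← Finset.mul_sum] at hneg
  have : ∑ j, mu j * (a (Sum.inr j) ^ 2 + (-a (Sum.inl j)) ^ 2) =
      ∑ j, mu j * (a (Sum.inl j) ^ 2 + a (Sum.inr j) ^ 2) :=
    Finset.sum_congr rfl fun j _ => by ring
  linarith

variable {X : Type*} [Fintype X]

/-- The rows of a normalising matrix form a basis. -/
theorem exists_leftInverse_of_symplectic [DecidableEq X]
    (hX : Fintype.card X = 2 * Fintype.card ι)
    {ω : Matrix X X ℝ} {S : Matrix (ι ⊕ ι) X ℝ} (hS : S * ω * Sᵀ = stdJ ι) :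
    ∃ Z : Matrix X (ι ⊕ ι) ℝ, Z * S = 1 := by
  refine ⟨-(ω * Sᵀ * stdJ ι), (mul_eq_one_comm_of_card_eq _ _ _ ?_).1 ?_⟩
  · rw [hX, Fintype.card_sum, two_mul]
  · rw [Matrix.mul_neg, ← Matrix.mul_assoc, ← Matrix.mul_assoc, hS, stdJ_mul_self, neg_neg]

/-- Monotonicity of the ordered symplectic eigenvalues. -/
theorem HasSymplecticSpectrum.le_of_le {N : ℕ} (hX : Fintype.card X = 2 * N)
    {ω M M' : Matrix X X ℝ} {lam mu : Fin N → ℝ} (hM : HasSymplecticSpectrum ω M lam)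
    (hM' : HasSymplecticSpectrum ω M' mu) (hlam : Antitone lam) (hmu : Antitone mu)
    (hpos : ∀ j, 0 < lam j) (hle : ∀ x, x ⬝ᵥ M *ᵥ x ≤ x ⬝ᵥ M' *ᵥ x) (k : Fin N) :
    lam k ≤ mu k := by
  classical
  obtain ⟨S, hSω, hSM⟩ := hM
  obtain ⟨S', hSω', hSM'⟩ := hM'
  obtain ⟨Z, hZ⟩ := exists_leftInverse_of_symplectic (by simpa using hX) hSω
  have key : ∀ (W : Matrix X X ℝ),
      (Zᵀ * S'ᵀ)ᵀ * (S * W * Sᵀ) * (Zᵀ * S'ᵀ) = S' * W * S'ᵀ := by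
    intro W
    calc _ = S' * (Z * S) * W * (Z * S)ᵀ * S'ᵀ := by
          simp only [transpose_mul, transpose_transpose, Matrix.mul_assoc]
      _ = _ := by simp [hZ]
  refine le_of_symplectic_congruence (P := Zᵀ * S'ᵀ) ?_ hlam hmu hpos (fun a => ?_) k
  · rw [← hSω, key, hSω', hSω]
  · rw [dotProduct_mulVec_mulVec, ← hSM, key, ← hSM']
    have := hle (S'ᵀ *ᵥ a)
    rwa [dotProduct_mulVec_mulVec, dotProduct_mulVec_mulVec, transpose_transpose] at this

end Monotonicity

section Structure

variable {ι κ X Y : Type*} [DecidableEq ι] [DecidableEq κ] [Fintype X] [Fintype Y]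

theorem HasSymplecticSpectrum.comp_equiv {ω M : Matrix X X ℝ} {lam : ι → ℝ}
    (h : HasSymplecticSpectrum ω M lam) (σ : κ ≃ ι) : HasSymplecticSpectrum ω M (lam ∘ σ) := by
  obtain ⟨S, hω, hM⟩ := h
  have key : ∀ W : Matrix X X ℝ, S.submatrix (Sum.map σ σ) id * W *
      (S.submatrix (Sum.map σ σ) id)ᵀ = (S * W * Sᵀ).submatrix (Sum.map σ σ) (Sum.map σ σ) :=
    fun W => rfl
  refine ⟨S.submatrix (Sum.map σ σ) id, ?_, ?_⟩
  · rw [key, hω]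
    ext (i | i) (j | j) <;> simp [stdJ, one_apply]
  · rw [key, hM]
    ext (i | i) (j | j) <;> simp [doubleDiag, diagonal_apply]

theorem HasSymplecticSpectrum.smul {ω M : Matrix X X ℝ} {lam : ι → ℝ}
    (h : HasSymplecticSpectrum ω M lam) (c : ℝ) : HasSymplecticSpectrum ω (c • M) (c • lam) := by
  obtain ⟨S, hω, hM⟩ := h
  refine ⟨S, hω, ?_⟩
  rw [Matrix.mul_smul, Matrix.smul_mul, hM]
  ext (i | i) (j | j) <;> simp [doubleDiag, diagonal_apply]

theorem HasSymplecticSpectrum.fromBlocks_diag {ω M : Matrix X X ℝ} {lam : ι → ℝ}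
    {ω' M' : Matrix Y Y ℝ} {mu : κ → ℝ}
    (h : HasSymplecticSpectrum ω M lam) (h' : HasSymplecticSpectrum ω' M' mu) :
    HasSymplecticSpectrum (fromBlocks ω 0 0 ω') (fromBlocks M 0 0 M') (Sum.elim lam mu) := by
  obtain ⟨S, hω, hM⟩ := h
  obtain ⟨S', hω', hM'⟩ := h'
  let f := Equiv.sumSumSumComm ι κ ι κ
  have key : ∀ (W : Matrix X X ℝ) (W' : Matrix Y Y ℝ),
      (fromBlocks S 0 0 S').submatrix f id * fromBlocks W 0 0 W' *
        ((fromBlocks S 0 0 S').submatrix f id)ᵀ =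
      (fromBlocks (S * W * Sᵀ) 0 0 (S' * W' * S'ᵀ)).submatrix f f := by
    intro W W'
    have : fromBlocks (S * W * Sᵀ) 0 0 (S' * W' * S'ᵀ) =
        fromBlocks S 0 0 S' * fromBlocks W 0 0 W' *
          (fromBlocks S 0 0 S')ᵀ := by
      simp [fromBlocks_multiply, fromBlocks_transpose]
    rw [this]
    rfl
  refine ⟨(fromBlocks S 0 0 S').submatrix f id, ?_, ?_⟩
  · rw [key, hω, hω']
    ext ((i | i) | (i | i)) ((j | j) | (j | j)) <;> simp [f, stdJ, one_apply]
  · rw [key, hM, hM']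
    ext ((i | i) | (i | i)) ((j | j) | (j | j)) <;> simp [f, doubleDiag, diagonal_apply]

theorem HasSymplecticSpectrum.of_congruence {ω M T : Matrix X X ℝ} {lam : ι → ℝ}
    (hT : T * ω * Tᵀ = ω) (h : HasSymplecticSpectrum ω (T * M * Tᵀ) lam) :
    HasSymplecticSpectrum ω M lam := by
  obtain ⟨S, hω, hM⟩ := h
  refine ⟨S * T, ?_, ?_⟩
  · rw [← hω]
    nth_rw 2 [← hT]
    simp only [transpose_mul, Matrix.mul_assoc]
  · rw [← hM]
    simp only [transpose_mul, Matrix.mul_assoc]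

theorem HasSymplecticSpectrum.reindex {ω M : Matrix X X ℝ} {lam : ι → ℝ} (e : Y ≃ X)
    (h : HasSymplecticSpectrum (ω.submatrix e e) (M.submatrix e e) lam) :
    HasSymplecticSpectrum ω M lam := by
  obtain ⟨S, hω, hM⟩ := h
  have key : ∀ W : Matrix X X ℝ, S.submatrix id e.symm * W * (S.submatrix id e.symm)ᵀ =
      S * W.submatrix e e * Sᵀ := by
    intro W
    have hW : W = (W.submatrix e e).submatrix e.symm e.symm := by simp
    conv_lhs => rw [hW]
    rw [transpose_submatrix, submatrix_mul_equiv, submatrix_mul_equiv, submatrix_id_id]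
  exact ⟨S.submatrix id e.symm, by rw [key, hω], by rw [key, hM]⟩

theorem HasSymplecticSpectrum.pos {ω M : Matrix X X ℝ} {lam : ι → ℝ}
    (h : HasSymplecticSpectrum ω M lam) (hM : M.PosDef) (j : ι) : 0 < lam j := by
  obtain ⟨S, hω, hS⟩ := h
  have hrow : S (Sum.inl j) ≠ 0 := by
    intro h0
    have h1 := congrFun (congrFun hω (Sum.inl j)) (Sum.inr j)
    have h2 : (S * ω * Sᵀ) (Sum.inl j) (Sum.inr j) =
        S (Sum.inl j) ⬝ᵥ ω *ᵥ S (Sum.inr j) := by rw [Matrix.mul_assoc]; rfl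
    rw [h2, h0] at h1
    simp [stdJ] at h1
  have h1 := congrFun (congrFun hS (Sum.inl j)) (Sum.inl j)
  have h2 : (S * M * Sᵀ) (Sum.inl j) (Sum.inl j) =
      S (Sum.inl j) ⬝ᵥ M *ᵥ S (Sum.inl j) := by rw [Matrix.mul_assoc]; rfl
  have h3 := hM.dotProduct_mulVec_pos hrow
  rw [star_trivial, ← h2, h1] at h3
  simpa [doubleDiag] using h3

theorem exists_equiv_antitone {N : ℕ} (lam : Fin N → ℝ) :
    ∃ σ : Fin N ≃ Fin N, Antitone (lam ∘ σ) :=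
  ⟨Tuple.sort (-lam), fun i j hij => by
    have := Tuple.monotone_sort (-lam) hij
    simpa using this⟩

end Structure

section Coordinates

/-- Sends the two quadratures of mode `j` to the coordinates `2 j` and `2 j + 1`. -/
def modeEquiv {d N : ℕ} (h : d = 2 * N) : Fin N ⊕ Fin N ≃ Fin d where
  toFun := Sum.elim (fun j => ⟨2 * j, by omega⟩) (fun j => ⟨2 * j + 1, by omega⟩)
  invFun i := if (i : ℕ) % 2 = 0 then Sum.inl ⟨i / 2, by omega⟩ else Sum.inr ⟨i / 2, by omega⟩
  left_inv := by
    rintro (j | j)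
    · simp
    · have : (2 * (j : ℕ) + 1) / 2 = j := by omega
      simp [this]
  right_inv i := by
    ext
    dsimp only
    split_ifs <;> simp <;> omega

variable {d N : ℕ}

theorem Jmat_submatrix_modeEquiv (h : d = 2 * N) :
    (Jmat d).submatrix (modeEquiv h) (modeEquiv h) = stdJ (Fin N) := by
  ext (i | i) (j | j) <;>
    simp only [submatrix_apply, Jmat, modeEquiv, stdJ, Equiv.coe_fn_mk, Sum.elim_inl, Sum.elim_inr,
      fromBlocks_apply₁₁, fromBlocks_apply₁₂, fromBlocks_apply₂₁, fromBlocks_apply₂₂,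
      Matrix.zero_apply, Matrix.neg_apply, one_apply, Fin.ext_iff] <;>
    grind

theorem Dmat_submatrix_modeEquiv (h : d = 2 * N) (v : ℕ → ℝ) :
    (Dmat d v).submatrix (modeEquiv h) (modeEquiv h) = doubleDiag fun j : Fin N => v j := by
  have h1 : ∀ j : ℕ, (2 * j + 1) / 2 = j := fun j => by omega
  ext (i | i) (j | j) <;>
    simp [Dmat, modeEquiv, doubleDiag, diagonal_apply, Fin.ext_iff, h1] <;> omega

theorem hasSymplecticSpectrum_of_isSymplectic (h : d = 2 * N) {S M : Matrix (Fin d) (Fin d) ℝ}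
    {v : ℕ → ℝ} (hS : IsSymplectic S) (hM : S * M * Sᵀ = Dmat d v) :
    HasSymplecticSpectrum (Jmat d) M fun j : Fin N => v j := by
  refine ⟨S.submatrix (modeEquiv h) id, ?_, ?_⟩
  · rw [← Jmat_submatrix_modeEquiv h]
    nth_rw 2 [← hS]
    rfl
  · rw [← Dmat_submatrix_modeEquiv h, ← hM]
    rfl

theorem HasSymplecticSpectrum.exists_isSymplectic (h : d = 2 * N) {M : Matrix (Fin d) (Fin d) ℝ}
    {lam : Fin N → ℝ} (hM : HasSymplecticSpectrum (Jmat d) M lam) {v : ℕ → ℝ}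
    (hv : ∀ j : Fin N, v j = lam j) : ∃ S, IsSymplectic S ∧ S * M * Sᵀ = Dmat d v := by
  obtain ⟨S, hω, hS⟩ := hM
  have key : ∀ W : Matrix (Fin d) (Fin d) ℝ,
      S.submatrix (modeEquiv h).symm id * W * (S.submatrix (modeEquiv h).symm id)ᵀ =
        (S * W * Sᵀ).submatrix (modeEquiv h).symm (modeEquiv h).symm := fun W => rfl
  refine ⟨S.submatrix (modeEquiv h).symm id, ?_, ?_⟩
  · rw [IsSymplectic, key, hω, ← Jmat_submatrix_modeEquiv h]
    simp
  · rw [key, hS, ← funext hv, ← Dmat_submatrix_modeEquiv h]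
    simp

theorem Jmat_transpose (d : ℕ) : (Jmat d)ᵀ = -Jmat d := by
  ext i j
  simp only [transpose_apply, Matrix.neg_apply, Jmat]
  split_ifs <;> first | omega | simp

theorem Jmat_mul_self (h : d = 2 * N) : Jmat d * Jmat d = -1 := by
  have : Jmat d = (stdJ (Fin N)).submatrix (modeEquiv h).symm (modeEquiv h).symm := by
    rw [← Jmat_submatrix_modeEquiv h]; simp
  rw [this, submatrix_mul_equiv, stdJ_mul_self, submatrix_neg]
  simp

theorem hasSymplecticSpectrum_one (h : d = 2 * N) :
    HasSymplecticSpectrum (Jmat d) 1 fun _ : Fin N => 1 :=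
  hasSymplecticSpectrum_of_isSymplectic h (S := 1) (v := fun _ => 1) (by simp [IsSymplectic])
    (by simp [Dmat])

theorem Jmat_submatrix_finSumFinEquiv (a b : ℕ) (ha : Even a) :
    (Jmat (a + b)).submatrix finSumFinEquiv finSumFinEquiv = fromBlocks (Jmat a) 0 0 (Jmat b) := by
  obtain ⟨c, rfl⟩ := ha
  ext (i | i) (j | j) <;>
    simp only [submatrix_apply, Jmat, finSumFinEquiv_apply_left, finSumFinEquiv_apply_right,
      fromBlocks_apply₁₁, fromBlocks_apply₁₂, fromBlocks_apply₂₁, fromBlocks_apply₂₂,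
      Matrix.zero_apply, Fin.val_castAdd, Fin.val_natAdd] <;>
    grind

theorem IA0B_submatrix_finSumFinEquiv (a b : ℕ) :
    (IA0B (a + b) a).submatrix finSumFinEquiv finSumFinEquiv = fromBlocks 1 0 0 0 := by
  ext (i | i) (j | j) <;>
    simp [IA0B, diagonal_apply, one_apply, Fin.ext_iff]
  omega

theorem assemble2_submatrix_finSumFinEquiv {a b : ℕ} (A : Matrix (Fin a) (Fin a) ℝ)
    (K : Matrix (Fin a) (Fin b) ℝ) (B : Matrix (Fin b) (Fin b) ℝ) :
    (assemble2 A K B).submatrix finSumFinEquiv finSumFinEquiv = fromBlocks A K Kᵀ B := by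
  ext (i | i) (j | j) <;> simp [assemble2]

end Coordinates

section FirstOrder

open scoped Topology

variable {X : Type*} [Fintype X]

theorem abs_dotProduct_mulVec_le (R : Matrix X X ℝ) (x : X → ℝ) :
    |x ⬝ᵥ R *ᵥ x| ≤ (∑ i, ∑ j, |R i j|) * (x ⬝ᵥ x) := by
  have hs : ∀ i, x i ^ 2 ≤ x ⬝ᵥ x := fun i => by
    rw [sq]
    exact Finset.single_le_sum (f := fun i => x i * x i) (fun i _ => mul_self_nonneg _)
      (Finset.mem_univ i)
  have hij : ∀ i j, |x i * x j| ≤ x ⬝ᵥ x := fun i j => by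
    rw [abs_le]
    constructor <;> nlinarith [hs i, hs j, sq_nonneg (x i + x j), sq_nonneg (x i - x j)]
  have hexp : x ⬝ᵥ R *ᵥ x = ∑ i, ∑ j, R i j * (x i * x j) := by
    simp only [dotProduct, mulVec, Finset.mul_sum]
    exact Finset.sum_congr rfl fun i _ => Finset.sum_congr rfl fun j _ => by ring
  rw [hexp, Finset.sum_mul]
  refine (Finset.abs_sum_le_sum_abs _ _).trans (Finset.sum_le_sum fun i _ => ?_)
  rw [Finset.sum_mul]
  refine (Finset.abs_sum_le_sum_abs _ _).trans (Finset.sum_le_sum fun j _ => ?_)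
  rw [abs_mul]
  exact mul_le_mul_of_nonneg_left (hij i j) (abs_nonneg _)

variable [DecidableEq X]

theorem cayley_congruence {ω Y : Matrix X X ℝ} (h : Y * ω = -(ω * Yᵀ)) (hu : IsUnit (1 - Y).det) :
    ((1 - Y)⁻¹ * (1 + Y)) * ω * ((1 - Y)⁻¹ * (1 + Y))ᵀ = ω := by
  have h1 : (1 + Y) * ω * (1 + Y)ᵀ = (1 - Y) * ω * (1 - Y)ᵀ := by
    simp only [transpose_add, transpose_sub, transpose_one, Matrix.add_mul, Matrix.sub_mul,
      Matrix.mul_add, Matrix.mul_sub, Matrix.one_mul, Matrix.mul_one, h, Matrix.neg_mul]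
    abel
  calc ((1 - Y)⁻¹ * (1 + Y)) * ω * ((1 - Y)⁻¹ * (1 + Y))ᵀ
      = (1 - Y)⁻¹ * ((1 + Y) * ω * (1 + Y)ᵀ) * ((1 - Y)⁻¹)ᵀ := by
        simp only [transpose_mul, Matrix.mul_assoc]
    _ = ((1 - Y)⁻¹ * (1 - Y)) * ω * ((1 - Y)⁻¹ * (1 - Y))ᵀ := by
        rw [h1]; simp only [transpose_mul, Matrix.mul_assoc]
    _ = ω := by rw [nonsing_inv_mul _ hu]; simp

/-- If `G` generates symplectic maps, `M₀ + ε M₁` agrees up to symplectic congruence with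
`M₀ + ε (M₁ + G M₀ + M₀ Gᵀ)` to first order in `ε`. -/
theorem exists_symplectic_congruence_first_order {ω G : Matrix X X ℝ} (hG : G * ω = -(ω * Gᵀ))
    (M₀ M₁ : Matrix X X ℝ) : ∃ c > (0 : ℝ), ∀ᶠ ε in 𝓝 (0 : ℝ), ∃ T : Matrix X X ℝ,
      T * ω * Tᵀ = ω ∧ ∀ x, |x ⬝ᵥ (T * (M₀ + ε • M₁) * Tᵀ) *ᵥ x -
        x ⬝ᵥ (M₀ + ε • (M₁ + G * M₀ + M₀ * Gᵀ)) *ᵥ x| ≤ c * ε ^ 2 * (x ⬝ᵥ x) := by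
  let Y : ℝ → Matrix X X ℝ := fun ε => (ε / 2) • G
  have hYc : Continuous Y := by fun_prop
  have hdet : ContinuousAt (fun ε => (1 - Y ε).det) 0 :=
    (Continuous.matrix_det (by fun_prop)).continuousAt
  have hdet0 : (1 - Y 0).det ≠ 0 := by simp [Y]
  let Z : ℝ → Matrix X X ℝ := fun ε => (1 - Y ε)⁻¹
  have hZ : ContinuousAt Z 0 := by
    have : Z = fun ε => ((1 - Y ε).det)⁻¹ • (1 - Y ε).adjugate := by
      funext ε; simp [Z, inv_def]
    rw [this]
    exact (hdet.inv₀ hdet0).smul (Continuous.matrix_adjugate (by fun_prop)).continuousAt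
  let Q : ℝ → Matrix X X ℝ := fun ε => (1 / 2 : ℝ) • (Z ε * (G * G))
  let P : ℝ → Matrix X X ℝ := fun ε => G + ε • Q ε
  let R : ℝ → Matrix X X ℝ := fun ε => Q ε * M₀ + M₀ * (Q ε)ᵀ + P ε * M₁ + M₁ * (P ε)ᵀ +
    P ε * (M₀ + ε • M₁) * (P ε)ᵀ
  have hQ : ContinuousAt Q 0 := by fun_prop
  have hP : ContinuousAt P 0 := by fun_prop
  have hR : ContinuousAt R 0 := by fun_prop
  let φ : ℝ → ℝ := fun ε => ∑ i, ∑ j, |R ε i j|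
  have hφ : ContinuousAt φ 0 := by fun_prop
  have hφ0 : 0 ≤ φ 0 := by positivity
  refine ⟨φ 0 + 1, by positivity, ?_⟩
  filter_upwards [hdet.eventually_ne hdet0, hφ.eventually_lt continuousAt_const
    (show φ 0 < φ 0 + 1 by linarith)] with ε hε hεφ
  have hunit : IsUnit (1 - Y ε).det := hε.isUnit
  refine ⟨(1 - Y ε)⁻¹ * (1 + Y ε), cayley_congruence ?_ hunit, fun x => ?_⟩
  · simp [Y, hG]
  have hT : (1 - Y ε)⁻¹ * (1 + Y ε) = 1 + ε • P ε := by
    have h1 : 1 + Y ε = (1 - Y ε) * (1 + ε • G) + (ε ^ 2 / 2) • (G * G) := by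
      simp only [Y, Matrix.sub_mul, Matrix.mul_add, Matrix.one_mul, Matrix.mul_one,
        Matrix.smul_mul, Matrix.mul_smul]
      module
    rw [h1, Matrix.mul_add, ← Matrix.mul_assoc, nonsing_inv_mul _ hunit, Matrix.one_mul,
      Matrix.mul_smul]
    simp only [P, Q, Z]
    module
  have hrem : (1 + ε • P ε) * (M₀ + ε • M₁) * (1 + ε • P ε)ᵀ =
      M₀ + ε • (M₁ + G * M₀ + M₀ * Gᵀ) + ε ^ 2 • R ε := by
    simp only [R, P, transpose_add, transpose_smul, transpose_one, Matrix.add_mul, Matrix.mul_add,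
      Matrix.one_mul, Matrix.mul_one, Matrix.smul_mul, Matrix.mul_smul, smul_smul, smul_add]
    module
  rw [hT, hrem, add_mulVec, dotProduct_add, add_sub_cancel_left, smul_mulVec, dotProduct_smul,
    smul_eq_mul, abs_mul, abs_of_nonneg (sq_nonneg ε)]
  have hxx : 0 ≤ x ⬝ᵥ x := Finset.sum_nonneg fun i _ => mul_self_nonneg _
  calc ε ^ 2 * |x ⬝ᵥ R ε *ᵥ x| ≤ ε ^ 2 * ((φ 0 + 1) * (x ⬝ᵥ x)) := by
        gcongr
        exact (abs_dotProduct_mulVec_le _ _).trans (mul_le_mul_of_nonneg_right hεφ.le hxx)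
    _ = (φ 0 + 1) * ε ^ 2 * (x ⬝ᵥ x) := by ring

end FirstOrder

section Perturbation

theorem exists_dotProduct_le_mul {X : Type*} [Fintype X] [DecidableEq X] {B : Matrix X X ℝ}
    (hB : B.PosDef) : ∃ s ≥ (0 : ℝ), ∀ y, y ⬝ᵥ y ≤ s * (y ⬝ᵥ B *ᵥ y) := by
  obtain ⟨G, hGu, hG⟩ := exists_isUnit_congruence_one hB
  refine ⟨∑ i, ∑ j, |(G * Gᵀ) i j|, by positivity, fun y => ?_⟩
  have hGd : IsUnit Gᵀ.det := by rw [det_transpose]; exact (isUnit_iff_isUnit_det _).1 hGu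
  obtain ⟨z, rfl⟩ : ∃ z, Gᵀ *ᵥ z = y :=
    ⟨(Gᵀ)⁻¹ *ᵥ y, by rw [mulVec_mulVec, mul_nonsing_inv _ hGd, one_mulVec]⟩
  have h1 := dotProduct_mulVec_mulVec Gᵀ 1 z z
  rw [one_mulVec, transpose_transpose, Matrix.mul_one] at h1
  rw [h1, dotProduct_mulVec_mulVec, transpose_transpose, hG, one_mulVec]
  exact (le_abs_self _).trans (abs_dotProduct_mulVec_le _ _)

theorem dotProduct_fromBlocks_diag_mulVec {X Y : Type*} [Fintype X] [Fintype Y]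
    (P : Matrix X X ℝ) (Q : Matrix Y Y ℝ) (x : X ⊕ Y → ℝ) : x ⬝ᵥ fromBlocks P 0 0 Q *ᵥ x =
      (x ∘ Sum.inl) ⬝ᵥ P *ᵥ (x ∘ Sum.inl) + (x ∘ Sum.inr) ⬝ᵥ Q *ᵥ (x ∘ Sum.inr) := by
  rw [fromBlocks_mulVec, dotProduct, Fintype.sum_sum_type]
  simp [dotProduct]

theorem antitone_sumElim_comp_finSumFinEquiv {m n : ℕ} {f : Fin m → ℝ} {g : Fin n → ℝ}
    (hf : Antitone f) (hg : Antitone g) (hgf : ∀ i j, g j ≤ f i) :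
    Antitone (Sum.elim f g ∘ finSumFinEquiv.symm) := by
  intro i j hij
  obtain ⟨i, rfl⟩ := finSumFinEquiv.surjective i
  obtain ⟨j, rfl⟩ := finSumFinEquiv.surjective j
  rcases i with i | i <;> rcases j with j | j <;>
    simp only [Function.comp_apply, Equiv.symm_apply_apply, Sum.elim_inl, Sum.elim_inr]
  · exact hf hij
  · exact hgf i j
  · rw [Fin.le_def, finSumFinEquiv_apply_left, finSumFinEquiv_apply_right] at hij
    simp only [Fin.val_natAdd, Fin.val_castAdd] at hij
    omega
  · refine hg ?_
    rw [Fin.le_def, finSumFinEquiv_apply_right, finSumFinEquiv_apply_right] at hij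
    simpa using hij

/-- A multiplicative sandwich of `M` by a block-diagonal form whose spectra are separated
controls the symplectic spectrum of `M`. -/
theorem HasSymplecticSpectrum.abs_sub_le_of_sandwich {X Y : Type*} [Fintype X] [Fintype Y]
    {m n : ℕ} (hX : Fintype.card X = 2 * m) (hY : Fintype.card Y = 2 * n)
    {ω P : Matrix X X ℝ} {ω' Q : Matrix Y Y ℝ} {M : Matrix (X ⊕ Y) (X ⊕ Y) ℝ}
    {η : Fin m → ℝ} {κ : Fin n → ℝ} {lam : Fin (m + n) → ℝ}
    (hP : HasSymplecticSpectrum ω P η) (hQ : HasSymplecticSpectrum ω' Q κ)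
    (hM : HasSymplecticSpectrum (fromBlocks ω 0 0 ω') M lam)
    (hη : Antitone η) (hκ : Antitone κ) (hlam : Antitone lam)
    (hη1 : ∀ i, 1 ≤ η i) (hκ0 : ∀ j, 0 < κ j) (hκ1 : ∀ j, κ j ≤ 1 / 4) (hlam0 : ∀ k, 0 < lam k)
    {p q : ℝ} (hp0 : 0 ≤ p) (hp : p ≤ 1 / 2) (hq0 : 0 ≤ q) (hq : q ≤ 1 / 2)
    (hlow : ∀ x, x ⬝ᵥ fromBlocks ((1 - p) • P) 0 0 ((1 - q) • Q) *ᵥ x ≤ x ⬝ᵥ M *ᵥ x)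
    (hupp : ∀ x, x ⬝ᵥ M *ᵥ x ≤ x ⬝ᵥ fromBlocks ((1 + p) • P) 0 0 ((1 + q) • Q) *ᵥ x) :
    (∀ i, |lam (finSumFinEquiv (Sum.inl i)) - η i| ≤ p * η i) ∧
      ∀ j, |lam (finSumFinEquiv (Sum.inr j)) - κ j| ≤ q * κ j := by
  have hcard : Fintype.card (X ⊕ Y) = 2 * (m + n) := by rw [Fintype.card_sum, hX, hY, mul_add]
  have hspec : ∀ a b : ℝ, HasSymplecticSpectrum (fromBlocks ω 0 0 ω')
      (fromBlocks (a • P) 0 0 (b • Q)) (Sum.elim (a • η) (b • κ) ∘ finSumFinEquiv.symm) :=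
    fun a b => ((hP.smul a).fromBlocks_diag (hQ.smul b)).comp_equiv finSumFinEquiv.symm
  have hanti : ∀ a b : ℝ, 1 / 2 ≤ a → 0 ≤ b → b ≤ 3 / 2 →
      Antitone (Sum.elim (a • η) (b • κ) ∘ finSumFinEquiv.symm) := by
    intro a b ha hb hb'
    refine antitone_sumElim_comp_finSumFinEquiv
      (fun i j hij => mul_le_mul_of_nonneg_left (hη hij) (by linarith))
      (fun i j hij => mul_le_mul_of_nonneg_left (hκ hij) hb) fun i j => ?_
    simp only [Pi.smul_apply, smul_eq_mul]
    nlinarith [hη1 i, hκ0 j, hκ1 j]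
  have hL := (hspec (1 - p) (1 - q)).le_of_le hcard hM
    (hanti _ _ (by linarith) (by linarith) (by linarith)) hlam (fun k => by
      obtain ⟨k, rfl⟩ := finSumFinEquiv.surjective k
      rcases k with i | j <;>
        simp only [Function.comp_apply, Equiv.symm_apply_apply, Sum.elim_inl, Sum.elim_inr,
          Pi.smul_apply, smul_eq_mul]
      · exact mul_pos (by linarith) (by linarith [hη1 i])
      · exact mul_pos (by linarith) (hκ0 j)) hlow
  have hU := hM.le_of_le hcard (hspec (1 + p) (1 + q)) hlam
    (hanti _ _ (by linarith) (by linarith) (by linarith)) hlam0 hupp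
  refine ⟨fun i => ?_, fun j => ?_⟩
  · have h1 := hL (finSumFinEquiv (Sum.inl i))
    have h2 := hU (finSumFinEquiv (Sum.inl i))
    simp only [Function.comp_apply, Equiv.symm_apply_apply, Sum.elim_inl,
      Pi.smul_apply, smul_eq_mul] at h1 h2
    rw [abs_le]
    constructor <;> linarith
  · have h1 := hL (finSumFinEquiv (Sum.inr j))
    have h2 := hU (finSumFinEquiv (Sum.inr j))
    simp only [Function.comp_apply, Equiv.symm_apply_apply, Sum.elim_inr,
      Pi.smul_apply, smul_eq_mul] at h1 h2
    rw [abs_le]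
    constructor <;> linarith

/-- The off-diagonal blocks of `[[A, K], [Kᵀ, B]]` are removed at first order by a symplectic
congruence. -/
theorem exists_symplectic_congruence_fromBlocks {a b m n : ℕ} (ha : a = 2 * m) (hb : b = 2 * n)
    (A : Matrix (Fin a) (Fin a) ℝ) (K : Matrix (Fin a) (Fin b) ℝ) (B : Matrix (Fin b) (Fin b) ℝ) :
    ∃ c > (0 : ℝ), ∀ᶠ ε in nhds (0 : ℝ), ∃ T : Matrix (Fin a ⊕ Fin b) (Fin a ⊕ Fin b) ℝ,
      T * fromBlocks (Jmat a) 0 0 (Jmat b) * Tᵀ = fromBlocks (Jmat a) 0 0 (Jmat b) ∧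
      ∀ x, |x ⬝ᵥ (T * (fromBlocks 1 0 0 0 + ε • fromBlocks A K Kᵀ B) * Tᵀ) *ᵥ x -
        x ⬝ᵥ fromBlocks (1 + ε • A) 0 0 (ε • B) *ᵥ x| ≤ c * ε ^ 2 * (x ⬝ᵥ x) := by
  have hA := Jmat_mul_self ha
  have hB := Jmat_mul_self hb
  obtain ⟨c, hc, h⟩ := exists_symplectic_congruence_first_order
    (ω := fromBlocks (Jmat a) 0 0 (Jmat b)) (G := fromBlocks 0 (-(Jmat a * K * Jmat b)) (-Kᵀ) 0)
    (by
      simp only [fromBlocks_transpose, fromBlocks_multiply, fromBlocks_neg, transpose_neg,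
        transpose_mul, Jmat_transpose, transpose_transpose, transpose_zero]
      congr 1
      · simp
      · simp [Matrix.mul_assoc, hB]
      · simp [← Matrix.mul_assoc, hB]
      · simp)
    (fromBlocks 1 0 0 0) (fromBlocks A K Kᵀ B)
  refine ⟨c, hc, ?_⟩
  have hN : ∀ ε : ℝ, fromBlocks (1 + ε • A) 0 0 (ε • B) = fromBlocks 1 0 0 0 +
      ε • (fromBlocks A K Kᵀ B + fromBlocks 0 (-(Jmat a * K * Jmat b)) (-Kᵀ) 0 *
        fromBlocks 1 0 0 0 + fromBlocks 1 0 0 0 *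
        (fromBlocks 0 (-(Jmat a * K * Jmat b)) (-Kᵀ) 0)ᵀ) := by
    intro ε
    simp [fromBlocks_transpose, fromBlocks_multiply, fromBlocks_add, fromBlocks_smul]
  simpa only [hN] using h

theorem exists_antitone_hasSymplecticSpectrum {X : Type*} [Fintype X] [DecidableEq X] {N : ℕ}
    (hX : Fintype.card X = 2 * N) {ω M : Matrix X X ℝ} (hω : ωᵀ = -ω) (hω2 : ω * ω = -1)
    (hM : M.PosDef) : ∃ lam : Fin N → ℝ, Antitone lam ∧ HasSymplecticSpectrum ω M lam := by
  have hu : IsUnit ω := .of_mul_eq_one (-ω) (by rw [Matrix.mul_neg, hω2, neg_neg])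
  obtain ⟨lam, h⟩ := exists_hasSymplecticSpectrum hX hω hu hM
  obtain ⟨σ, hσ⟩ := exists_equiv_antitone lam
  exact ⟨lam ∘ σ, hσ, h.comp_equiv σ⟩

theorem sandwich_of_abs_sub_le {X Y : Type*} [Fintype X] [Fintype Y] [DecidableEq X]
    {A : Matrix X X ℝ} {B : Matrix Y Y ℝ} {M : Matrix (X ⊕ Y) (X ⊕ Y) ℝ} {c s ε : ℝ} (hc : 0 ≤ c)
    (hε : 0 < ε) (hA : ∀ x, 0 ≤ x ⬝ᵥ A *ᵥ x) (hB : ∀ y, y ⬝ᵥ y ≤ s * (y ⬝ᵥ B *ᵥ y))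
    (h : ∀ x, |x ⬝ᵥ M *ᵥ x - x ⬝ᵥ fromBlocks (1 + ε • A) 0 0 (ε • B) *ᵥ x| ≤
      c * ε ^ 2 * (x ⬝ᵥ x)) (x : X ⊕ Y → ℝ) :
    x ⬝ᵥ fromBlocks ((1 - c * ε ^ 2) • (1 + ε • A)) 0 0 ((1 - c * s * ε) • (ε • B)) *ᵥ x ≤
        x ⬝ᵥ M *ᵥ x ∧
      x ⬝ᵥ M *ᵥ x ≤
        x ⬝ᵥ fromBlocks ((1 + c * ε ^ 2) • (1 + ε • A)) 0 0 ((1 + c * s * ε) • (ε • B)) *ᵥ x := by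
  have hxx : x ⬝ᵥ x = (x ∘ Sum.inl) ⬝ᵥ (x ∘ Sum.inl) + (x ∘ Sum.inr) ⬝ᵥ (x ∘ Sum.inr) := by
    simp [dotProduct]
  have h0 := h x
  rw [dotProduct_fromBlocks_diag_mulVec, hxx, abs_le] at h0
  rw [dotProduct_fromBlocks_diag_mulVec, dotProduct_fromBlocks_diag_mulVec]
  set a := x ∘ Sum.inl
  set b := x ∘ Sum.inr
  simp only [smul_mulVec, add_mulVec, one_mulVec, dotProduct_add, dotProduct_smul,
    smul_eq_mul] at h0 ⊢
  have h1 : 0 ≤ c * ε ^ 2 * (ε * (a ⬝ᵥ A *ᵥ a)) := by have := hA a; positivity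
  have h2 : c * ε ^ 2 * (b ⬝ᵥ b) ≤ c * ε ^ 2 * (s * (b ⬝ᵥ B *ᵥ b)) :=
    mul_le_mul_of_nonneg_left (hB b) (by positivity)
  constructor <;> linarith [h0.1, h0.2]

theorem exists_symplectic_spectra_close {m n : ℕ} {A : Matrix (Fin (2 * m)) (Fin (2 * m)) ℝ}
    {K : Matrix (Fin (2 * m)) (Fin (2 * n)) ℝ} {B : Matrix (Fin (2 * n)) (Fin (2 * n)) ℝ}
    (hpd : (fromBlocks A K Kᵀ B).PosDef) {nu : Fin n → ℝ}
    (hnu : HasSymplecticSpectrum (Jmat (2 * n)) B nu) :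
    ∃ C > (0 : ℝ), ∀ᶠ ε in nhds (0 : ℝ), 0 < ε → ∃ (lam : Fin (m + n) → ℝ) (eta : Fin m → ℝ),
      HasSymplecticSpectrum (fromBlocks (Jmat (2 * m)) 0 0 (Jmat (2 * n)))
        (fromBlocks 1 0 0 0 + ε • fromBlocks A K Kᵀ B) lam ∧
      HasSymplecticSpectrum (Jmat (2 * m)) (1 + ε • A) eta ∧
      (∀ i, |lam (finSumFinEquiv (Sum.inl i)) - eta i| ≤ C * ε ^ 2) ∧
      ∀ j, |lam (finSumFinEquiv (Sum.inr j)) - ε * nu j| ≤ C * ε ^ 2 := by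
  have hA : A.PosDef := hpd.submatrix Sum.inl_injective
  have hB : B.PosDef := hpd.submatrix Sum.inr_injective
  have hA0 : ∀ x, 0 ≤ x ⬝ᵥ A *ᵥ x := fun x => by
    simpa using hA.posSemidef.dotProduct_mulVec_nonneg x
  have hcardA : Fintype.card (Fin (2 * m)) = 2 * m := Fintype.card_fin _
  have hcardB : Fintype.card (Fin (2 * n)) = 2 * n := Fintype.card_fin _
  have hcard : Fintype.card (Fin (2 * m) ⊕ Fin (2 * n)) = 2 * (m + n) := by
    rw [Fintype.card_sum, hcardA, hcardB, mul_add]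
  have hωT : (fromBlocks (Jmat (2 * m)) 0 0 (Jmat (2 * n)))ᵀ =
      -fromBlocks (Jmat (2 * m)) 0 0 (Jmat (2 * n)) := by
    simp [fromBlocks_transpose, fromBlocks_neg, Jmat_transpose]
  have hω2 : fromBlocks (Jmat (2 * m)) 0 0 (Jmat (2 * n)) *
      fromBlocks (Jmat (2 * m)) 0 0 (Jmat (2 * n)) = -1 := by
    simp [fromBlocks_multiply, Jmat_mul_self rfl, ← fromBlocks_one, fromBlocks_neg]
  have hI : (fromBlocks 1 0 0 0 :
      Matrix (Fin (2 * m) ⊕ Fin (2 * n)) (Fin (2 * m) ⊕ Fin (2 * n)) ℝ).PosSemidef := by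
    rw [← IA0B_submatrix_finSumFinEquiv]
    exact (PosSemidef.diagonal fun i => by dsimp only; split_ifs <;> simp).submatrix _
  obtain ⟨s, hs, hsB⟩ := exists_dotProduct_le_mul hB
  obtain ⟨c, hc, hcT⟩ := exists_symplectic_congruence_fromBlocks rfl rfl A K B
  obtain ⟨τ, hτ⟩ := exists_equiv_antitone nu
  have hnu0 := hnu.pos hB
  obtain ⟨α, hα, hαA⟩ := exists_antitone_hasSymplecticSpectrum hcardA (Jmat_transpose _)
    (Jmat_mul_self rfl) (PosDef.one.add hA)
  have hα0 := hαA.pos (PosDef.one.add hA)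
  have hαL : ∀ i, α i ≤ ∑ i, α i := fun i =>
    Finset.single_le_sum (fun i _ => (hα0 i).le) (Finset.mem_univ i)
  have hnuV : ∀ j, nu j ≤ ∑ j, nu j := fun j =>
    Finset.single_le_sum (fun j _ => (hnu0 j).le) (Finset.mem_univ j)
  set L := ∑ i, α i
  set V := ∑ j, nu j
  have hL : 0 ≤ L := Finset.sum_nonneg fun i _ => (hα0 i).le
  have hV : 0 ≤ V := Finset.sum_nonneg fun j _ => (hnu0 j).le
  have hsmall : ∀ f : ℝ → ℝ, Continuous f → f 0 = 0 → ∀ r > 0, ∀ᶠ ε in nhds 0, f ε < r :=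
    fun f hf h0 r hr => hf.continuousAt.eventually_lt continuousAt_const (by rwa [h0])
  refine ⟨c * L + c * s * V + 1, by positivity, ?_⟩
  filter_upwards [hcT, hsmall (fun ε => ε) (by fun_prop) rfl 1 one_pos,
    hsmall (fun ε => c * ε ^ 2) (by fun_prop) (by simp) (1 / 2) (by norm_num),
    hsmall (fun ε => c * s * ε) (by fun_prop) (by simp) (1 / 2) (by norm_num),
    hsmall (fun ε => ε * V) (by fun_prop) (by simp) (1 / 4) (by norm_num)]
    with ε ⟨T, hTω, hT⟩ hε1 hp hq hκ hε
  have hAε : (1 + ε • A).PosDef := PosDef.one.add (hA.smul hε)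
  have hMε : (fromBlocks 1 0 0 0 + ε • fromBlocks A K Kᵀ B).PosDef :=
    PosDef.posSemidef_add hI (hpd.smul hε)
  obtain ⟨eta, heta, hetaA⟩ := exists_antitone_hasSymplecticSpectrum hcardA (Jmat_transpose _)
    (Jmat_mul_self rfl) hAε
  have heta1 : ∀ i, 1 ≤ eta i := (hasSymplecticSpectrum_one rfl).le_of_le hcardA hetaA
    antitone_const heta (fun _ => one_pos) fun x => by
      rw [add_mulVec, dotProduct_add, smul_mulVec, dotProduct_smul, smul_eq_mul]
      have := mul_nonneg hε.le (hA0 x)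
      linarith
  have hetaL : ∀ i, eta i ≤ L := fun i => (hetaA.le_of_le hcardA hαA heta hα
    (hetaA.pos hAε) (fun x => by
      simp only [add_mulVec, dotProduct_add, smul_mulVec, dotProduct_smul, smul_eq_mul]
      have := mul_le_mul_of_nonneg_right hε1.le (hA0 x)
      linarith) i).trans (hαL i)
  obtain ⟨T', hT'⟩ : IsUnit T := by
    rw [isUnit_iff_isUnit_det]
    have h1 := congrArg det hTω
    have h2 : (fromBlocks (Jmat (2 * m)) 0 0 (Jmat (2 * n))).det ≠ 0 := by
      intro h0
      have := congrArg det hω2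
      rw [det_mul, h0, zero_mul, det_neg, det_one, mul_one] at this
      exact pow_ne_zero _ (by norm_num) this.symm
    rw [det_mul, det_mul] at h1
    rw [isUnit_iff_ne_zero]
    intro h0
    rw [h0, zero_mul, zero_mul] at h1
    exact h2 h1.symm
  have hTpd : (T * (fromBlocks 1 0 0 0 + ε • fromBlocks A K Kᵀ B) * Tᵀ).PosDef := by
    have := (IsUnit.posDef_star_right_conjugate_iff (U := T) ⟨T', hT'⟩).2 hMε
    rwa [star_eq_conjTranspose, conjTranspose_eq_transpose_of_trivial] at this
  obtain ⟨lam, hlam, hlamM⟩ := exists_antitone_hasSymplecticSpectrum hcard hωT hω2 hTpd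
  have hsand := sandwich_of_abs_sub_le hc.le hε hA0 hsB hT
  obtain ⟨h1, h2⟩ := hetaA.abs_sub_le_of_sandwich hcardA hcardB ((hnu.comp_equiv τ).smul ε) hlamM
    heta (fun i j hij => mul_le_mul_of_nonneg_left (hτ hij) hε.le) hlam heta1
    (fun j => mul_pos hε (hnu0 _))
    (fun j => (mul_le_mul_of_nonneg_left (hnuV (τ j)) hε.le).trans hκ.le) (hlamM.pos hTpd)
    (by positivity) hp.le (by positivity) hq.le (fun x => (hsand x).1) (fun x => (hsand x).2)
  let ρ : Fin (m + n) ≃ Fin (m + n) :=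
    finSumFinEquiv.symm.trans (((Equiv.refl _).sumCongr τ.symm).trans finSumFinEquiv)
  refine ⟨lam ∘ ρ, eta, (hlamM.of_congruence hTω).comp_equiv ρ, hetaA, fun i => ?_, fun j => ?_⟩
  · have hρ : ρ (finSumFinEquiv (Sum.inl i)) = finSumFinEquiv (Sum.inl i) := by simp [ρ]
    rw [Function.comp_apply, hρ]
    have h3 : c * ε ^ 2 * eta i ≤ c * ε ^ 2 * L :=
      mul_le_mul_of_nonneg_left (hetaL i) (by positivity)
    have h4 : 0 ≤ (c * s * V + 1) * ε ^ 2 := by positivity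
    linarith [h1 i]
  · have hρ : ρ (finSumFinEquiv (Sum.inr j)) = finSumFinEquiv (Sum.inr (τ.symm j)) := by simp [ρ]
    rw [Function.comp_apply, hρ]
    have h2j := h2 (τ.symm j)
    simp only [Pi.smul_apply, Function.comp_apply, Equiv.apply_symm_apply, smul_eq_mul] at h2j
    have h3 : c * s * ε ^ 2 * nu j ≤ c * s * ε ^ 2 * V :=
      mul_le_mul_of_nonneg_left (hnuV j) (by positivity)
    have h4 : 0 ≤ (c * L + 1) * ε ^ 2 := by positivity
    linarith

end Perturbation

/-- Perturbation of the symplectic spectrum to first order,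
infinite-time form (Lemma 3.2(i)). -/
theorem symplectic_perturbation_first_order_infinite (m n : ℕ) (hm : 1 ≤ m) (hn : 1 ≤ n)
    (A : Matrix (Fin (2 * m)) (Fin (2 * m)) ℝ) (K : Matrix (Fin (2 * m)) (Fin (2 * n)) ℝ)
    (B : Matrix (Fin (2 * n)) (Fin (2 * n)) ℝ)
    (hsymm : (assemble2 A K B).IsSymm) (hpd : (assemble2 A K B).PosDef)
    (nu : ℕ → ℝ)
    (hnu : ∃ S_B : Matrix (Fin (2 * n)) (Fin (2 * n)) ℝ,
      IsSymplectic S_B ∧ S_B * B * S_B.transpose = Dmat (2 * n) nu) :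
    ∃ C > (0 : ℝ), ∃ eps₀ > (0 : ℝ), ∀ eps : ℝ, 0 < eps → eps < eps₀ →
      (IA0B (2 * m + 2 * n) (2 * m) + eps • assemble2 A K B).PosDef ∧
      (1 + eps • A).PosDef ∧
      ∃ (lamv etav : ℕ → ℝ) (S₁ : Matrix (Fin (2 * m + 2 * n)) (Fin (2 * m + 2 * n)) ℝ)
        (S₂ : Matrix (Fin (2 * m)) (Fin (2 * m)) ℝ),
        IsSymplectic S₁ ∧
        S₁ * (IA0B (2 * m + 2 * n) (2 * m) + eps • assemble2 A K B) * S₁.transpose =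
          Dmat (2 * m + 2 * n) lamv ∧
        IsSymplectic S₂ ∧
        S₂ * (1 + eps • A) * S₂.transpose = Dmat (2 * m) etav ∧
        (∀ j < m, |lamv j - etav j| ≤ C * eps ^ 2) ∧
        (∀ j < n, |lamv (m + j) - eps * nu j| ≤ C * eps ^ 2) := by
  obtain ⟨S_B, hS_B, hS_BM⟩ := hnu
  have hblk := assemble2_submatrix_finSumFinEquiv A K B
  have hpd' : (fromBlocks A K Kᵀ B).PosDef := by
    rw [← hblk]; exact hpd.submatrix finSumFinEquiv.injective
  have hA : A.PosDef := hpd'.submatrix Sum.inl_injective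
  obtain ⟨C, hC, hev⟩ := exists_symplectic_spectra_close hpd'
    (hasSymplecticSpectrum_of_isSymplectic rfl hS_B hS_BM)
  obtain ⟨δ, hδ, hδC⟩ := Metric.eventually_nhds_iff.1 hev
  refine ⟨C, hC, δ, hδ, fun eps heps hlt => ⟨?_, PosDef.one.add (hA.smul heps), ?_⟩⟩
  · exact PosDef.posSemidef_add
      (PosSemidef.diagonal fun i => by dsimp only; split_ifs <;> simp) (hpd.smul heps)
  obtain ⟨lam, eta, hlam, heta, h1, h2⟩ :=
    hδC (by rwa [Real.dist_eq, sub_zero, abs_of_pos heps]) heps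
  have hlam' : HasSymplecticSpectrum (Jmat (2 * m + 2 * n))
      (IA0B (2 * m + 2 * n) (2 * m) + eps • assemble2 A K B) lam := by
    refine .reindex finSumFinEquiv ?_
    rw [Jmat_submatrix_finSumFinEquiv _ _ (even_two_mul m), submatrix_add, submatrix_smul,
      Pi.add_apply, Pi.add_apply, Pi.smul_apply, Pi.smul_apply, IA0B_submatrix_finSumFinEquiv, hblk]
    exact hlam
  let lamv : ℕ → ℝ := fun j => if h : j < m + n then lam ⟨j, h⟩ else 0
  let etav : ℕ → ℝ := fun j => if h : j < m then eta ⟨j, h⟩ else 0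
  obtain ⟨S₁, hS₁, hS₁M⟩ := hlam'.exists_isSymplectic (mul_add 2 m n).symm (v := lamv)
    fun j => by simp [lamv]
  obtain ⟨S₂, hS₂, hS₂M⟩ := heta.exists_isSymplectic rfl (v := etav) fun j => by simp [etav]
  refine ⟨lamv, etav, S₁, S₂, hS₁, hS₁M, hS₂, hS₂M, fun j hj => ?_, fun j hj => ?_⟩
  · have hlamj : lamv j = lam (finSumFinEquiv (Sum.inl ⟨j, hj⟩)) := by
      simp [lamv, show j < m + n by omega]
    have hetaj : etav j = eta ⟨j, hj⟩ := by simp [etav, hj]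
    rw [hlamj, hetaj]
    exact h1 ⟨j, hj⟩
  · have hlamj : lamv (m + j) = lam (finSumFinEquiv (Sum.inr ⟨j, hj⟩)) := by
      simp [lamv, hj]
    rw [hlamj]
    exact h2 ⟨j, hj⟩

end
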